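/- Let λ_1, λ_2, θ ∈ ℕ with θ ≤ λ_2 and λ_1 + θ ≥ 1. Then, in the field ℚ(q, t) of rational functions, C_θ(q^{-λ_2}t^{-2}, q^{λ_1}; 2, λ_2) = t^θ · (q^{λ_2-θ+1};q)_θ/(tq^{λ_2-θ};q)_θ · (1/t;q)_θ/(q;q)_θ · (q^{λ_1+1};q)_θ/(tq^{λ_1+1};q)_θ · (tq^{λ_1};q)_{λ_2+θ}/(q^{λ_1+1};q)_{λ_2+θ} · (tq^{λ_1+1};q)_{λ_2}/(t²q^{λ_1};q)_{λ_2} · (1-q^{λ_1+2θ})/(1-q^{λ_1+θ}). -/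

import Mathlib

open Finset

/-- The `q`-shifted factorial `(a;q)_m` for an integer index `m`. -/
noncomputable def qPoch {K : Type*} [Field K] (a q : K) (m : ℤ) : K :=
  if 0 ≤ m then ∏ j ∈ Finset.range m.toNat, (1 - a * q ^ j)
  else (∏ j ∈ Finset.range (-m).toNat, (1 - a * q ^ (-(j : ℤ) - 1)))⁻¹

noncomputable abbrev KQT : Type := FractionRing (MvPolynomial (Fin 2) ℚ)

noncomputable def qq : KQT := algebraMap (MvPolynomial (Fin 2) ℚ) KQT (MvPolynomial.X 0)
noncomputable def tt : KQT := algebraMap (MvPolynomial (Fin 2) ℚ) KQT (MvPolynomial.X 1)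

/-- The coefficient `C_θ(u₀,u₁;2,r)` for the root system `A₂` (case `k = 2`),
where `v₁ = q^θ u₁`. -/
noncomputable def Ck2 (u₀ u₁ : KQT) (r θ : ℕ) : KQT :=
  qq ^ θ * (qPoch (tt ^ 2 * u₀) qq θ / qPoch (qq * tt * u₀) qq θ) *
    (qPoch (qq / tt) qq θ / qPoch qq qq θ) *
    (qPoch (qq * u₁) qq θ / qPoch (qq * tt * u₁) qq θ) *
    (qPoch (u₁ / (tt * u₀)) qq θ / qPoch (qq * u₁ / (tt ^ 2 * u₀)) qq θ) *
    (qPoch (qq * tt * u₀ / u₁) qq r / qPoch (tt ^ 2 * u₀ / u₁) qq r) *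
    (qPoch (tt * u₀ / u₁) qq r / qPoch (qq * u₀ / u₁) qq r) *
    (1 - (1 - tt * (qq ^ θ * u₁)) / (1 - qq ^ θ * u₁) *
      ((qq ^ θ * u₁ - u₁) / (qq ^ θ * u₁ - tt * u₁)))

section qPochhammer

variable {K : Type*} [Field K]

theorem qPoch_natCast (a q : K) (n : ℕ) :
    qPoch a q n = ∏ j ∈ Finset.range n, (1 - a * q ^ j) := by
  simp [qPoch]

theorem qPoch_natCast_add (a q : K) (m n : ℕ) :
    qPoch a q ((m : ℤ) + n) = qPoch a q m * qPoch (a * q ^ m) q n := by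
  rw [← Nat.cast_add]
  simp only [qPoch_natCast, Finset.prod_range_add, pow_add, mul_assoc]

/-- Shifting the base point of a `q`-shifted factorial by one. -/
theorem qPoch_mul_one_sub (a q : K) (n : ℕ) :
    qPoch a q n * (1 - a * q ^ n) = (1 - a) * qPoch (a * q) q n := by
  simp only [qPoch_natCast]
  rw [← Finset.prod_range_succ, Finset.prod_range_succ', mul_comm]
  simp [pow_succ', mul_assoc]

/-- Reversal of the order of the factors of a `q`-shifted factorial. -/
theorem qPoch_reverse {a b q : K} (hq : q ≠ 0) (ha : a ≠ 0) (n : ℕ)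
    (hab : a * b * q ^ n = q) :
    qPoch b q n = (-a⁻¹) ^ n * (∏ j ∈ Finset.range n, (q ^ j)⁻¹) * qPoch a q n := by
  simp only [qPoch_natCast]
  rw [← Finset.prod_range_reflect]
  nth_rewrite 3 [← Finset.card_range n]
  rw [← Finset.prod_const, ← Finset.prod_mul_distrib, ← Finset.prod_mul_distrib]
  refine Finset.prod_congr rfl fun j hj => ?_
  obtain ⟨k, rfl⟩ := Nat.exists_eq_add_of_lt (Finset.mem_range.mp hj)
  have hk : j + k + 1 - 1 - j = k := by omega
  rw [hk]
  have hqj : q ^ j ≠ 0 := pow_ne_zero _ hq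
  have h : a * b * q ^ k * q ^ j = 1 := by
    apply mul_right_cancel₀ hq
    rw [one_mul]
    linear_combination hab
  field_simp
  linear_combination -h

/-- Reversal applied to a quotient of two `q`-shifted factorials. -/
theorem qPoch_div_reverse {a b c d q : K} (hq : q ≠ 0) (ha : a ≠ 0) (hc : c ≠ 0) (n : ℕ)
    (hab : a * b * q ^ n = q) (hcd : c * d * q ^ n = q) :
    qPoch b q n / qPoch d q n = (c / a) ^ n * (qPoch a q n / qPoch c q n) := by
  rw [qPoch_reverse hq ha n hab, qPoch_reverse hq hc n hcd]
  have hP : ∏ j ∈ Finset.range n, (q ^ j)⁻¹ ≠ 0 :=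
    Finset.prod_ne_zero_iff.mpr fun j _ => inv_ne_zero (pow_ne_zero _ hq)
  have hfac : (-a⁻¹) ^ n / (-c⁻¹) ^ n = (c / a) ^ n := by
    rw [← div_pow]
    congr 1
    field_simp
  rw [← hfac, mul_div_mul_comm, mul_div_mul_comm, div_self hP, mul_one]

end qPochhammer

theorem qq_ne_zero : qq ≠ 0 := by
  simp [qq, MvPolynomial.X_ne_zero]

theorem tt_ne_zero : tt ≠ 0 := by
  simp [tt, MvPolynomial.X_ne_zero]

theorem qq_pow_ne_one {n : ℕ} (hn : n ≠ 0) : qq ^ n ≠ 1 := by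
  intro h
  rw [qq, ← map_pow, ← map_one (algebraMap (MvPolynomial (Fin 2) ℚ) KQT)] at h
  have h' := congrArg (MvPolynomial.eval fun _ => (0 : ℚ))
    (IsFractionRing.injective (MvPolynomial (Fin 2) ℚ) KQT h)
  simp [hn] at h'

theorem qq_pow_ne_tt (n : ℕ) : qq ^ n ≠ tt := by
  intro h
  rw [qq, tt, ← map_pow] at h
  have h' := congrArg (MvPolynomial.eval ![(1 : ℚ), 0])
    (IsFractionRing.injective (MvPolynomial (Fin 2) ℚ) KQT h)
  simp at h'

theorem stmt_6 (lam₁ lam₂ θ : ℕ) (hθ : θ ≤ lam₂) (hpos : 1 ≤ lam₁ + θ) :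
    Ck2 (qq ^ (-(lam₂ : ℤ)) * tt ^ (-2 : ℤ)) (qq ^ lam₁) lam₂ θ =
      tt ^ θ *
        (qPoch (qq ^ ((lam₂ : ℤ) - θ + 1)) qq θ / qPoch (tt * qq ^ ((lam₂ : ℤ) - θ)) qq θ) *
        (qPoch tt⁻¹ qq θ / qPoch qq qq θ) *
        (qPoch (qq ^ (lam₁ + 1)) qq θ / qPoch (tt * qq ^ (lam₁ + 1)) qq θ) *
        (qPoch (tt * qq ^ lam₁) qq (lam₂ + θ) / qPoch (qq ^ (lam₁ + 1)) qq (lam₂ + θ)) *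
        (qPoch (tt * qq ^ (lam₁ + 1)) qq lam₂ / qPoch (tt ^ 2 * qq ^ lam₁) qq lam₂) *
        ((1 - qq ^ (lam₁ + 2 * θ)) / (1 - qq ^ (lam₁ + θ))) := by
  have hq := qq_ne_zero
  have ht := tt_ne_zero
  have hv : 1 - qq ^ (lam₁ + θ) ≠ 0 := sub_ne_zero.mpr (qq_pow_ne_one (by omega)).symm
  have htθ : qq ^ θ - tt ≠ 0 := sub_ne_zero.mpr (qq_pow_ne_tt θ)
  obtain ⟨m, rfl⟩ := Nat.exists_eq_add_of_le' hθ
  have e₁ : ((m + θ : ℕ) : ℤ) - θ + 1 = ((m + 1 : ℕ) : ℤ) := by push_cast; ring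
  have e₂ : ((m + θ : ℕ) : ℤ) - θ = (m : ℤ) := by push_cast; ring
  rw [e₁, e₂, zpow_natCast, zpow_natCast, qPoch_natCast_add, qPoch_natCast_add, Ck2]
  simp only [zpow_neg, zpow_natCast, zpow_ofNat]
  generalize qq = q at *
  generalize tt = t at *
  set n := m + θ with hn
  have hl : q ^ lam₁ ≠ 0 := pow_ne_zero _ hq
  have hqn : q ^ n ≠ 0 := pow_ne_zero _ hq
  have hqm : q ^ m ≠ 0 := pow_ne_zero _ hq
  have hqθ : q ^ θ ≠ 0 := pow_ne_zero _ hq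
  have hnm : q ^ n = q ^ m * q ^ θ := by rw [hn, pow_add]
  have s₁ := qPoch_div_reverse (a := q ^ (m + 1)) (b := t ^ 2 * ((q ^ n)⁻¹ * (t ^ 2)⁻¹))
    (c := t * q ^ m) (d := q * t * ((q ^ n)⁻¹ * (t ^ 2)⁻¹)) hq (by simp [hq]) (by simp [hq, ht]) θ
    (by rw [hnm]; field_simp; ring) (by rw [hnm]; field_simp)
  have s₂ := qPoch_div_reverse (a := t * q ^ lam₁)
    (b := q * t * ((q ^ n)⁻¹ * (t ^ 2)⁻¹) / q ^ lam₁)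
    (c := q ^ (lam₁ + 1)) (d := t ^ 2 * ((q ^ n)⁻¹ * (t ^ 2)⁻¹) / q ^ lam₁)
    hq (by simp [hq, ht]) (by simp [hq]) n (by field_simp) (by field_simp; ring)
  have s₃ := qPoch_div_reverse (a := t * q ^ (lam₁ + 1))
    (b := t * ((q ^ n)⁻¹ * (t ^ 2)⁻¹) / q ^ lam₁)
    (c := t ^ 2 * q ^ lam₁) (d := q * ((q ^ n)⁻¹ * (t ^ 2)⁻¹) / q ^ lam₁)
    hq (by simp [hq, ht]) (by simp [hq, ht]) n (by field_simp; ring) (by field_simp)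
  have a₁ : q ^ lam₁ / (t * ((q ^ n)⁻¹ * (t ^ 2)⁻¹)) = t * q ^ lam₁ * q ^ n := by field_simp
  have a₂ : q * q ^ lam₁ / (t ^ 2 * ((q ^ n)⁻¹ * (t ^ 2)⁻¹)) = q ^ (lam₁ + 1) * q ^ n := by
    field_simp
    ring
  have a₃ : q * q ^ lam₁ = q ^ (lam₁ + 1) := by ring
  have a₄ : q * t * q ^ lam₁ = t * q ^ (lam₁ + 1) := by ring
  have c₁ : q ^ θ * (t * q ^ m / q ^ (m + 1)) ^ θ = t ^ θ := by
    rw [← mul_pow]; congr 1; field_simp; ring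
  have c₂ : (q ^ (lam₁ + 1) / (t * q ^ lam₁)) ^ n *
      (t ^ 2 * q ^ lam₁ / (t * q ^ (lam₁ + 1))) ^ n = 1 := by
    rw [← mul_pow]; convert one_pow n using 2; field_simp
  have c₃ : qPoch (q / t) q θ * (1 - (1 - t * (q ^ θ * q ^ lam₁)) / (1 - q ^ θ * q ^ lam₁) *
      ((q ^ θ * q ^ lam₁ - q ^ lam₁) / (q ^ θ * q ^ lam₁ - t * q ^ lam₁))) =
      qPoch t⁻¹ q θ * ((1 - q ^ (lam₁ + 2 * θ)) / (1 - q ^ (lam₁ + θ))) := by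
    have h := qPoch_mul_one_sub t⁻¹ q θ
    rw [inv_mul_eq_div t q] at h
    have hv' : 1 - q ^ θ * q ^ lam₁ ≠ 0 := by rwa [← pow_add, add_comm]
    have h₇ : 1 - (1 - t * (q ^ θ * q ^ lam₁)) / (1 - q ^ θ * q ^ lam₁) *
        ((q ^ θ * q ^ lam₁ - q ^ lam₁) / (q ^ θ * q ^ lam₁ - t * q ^ lam₁)) =
        (1 - t) / (q ^ θ - t) * ((1 - q ^ (lam₁ + 2 * θ)) / (1 - q ^ (lam₁ + θ))) := by
      rw [← sub_mul, pow_add, pow_add, pow_mul', mul_comm (q ^ lam₁) (q ^ θ)]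
      field_simp
      ring
    rw [h₇, ← mul_assoc]
    congr 1
    field_simp at h ⊢
    linear_combination h
  rw [s₁, s₂, s₃, a₁, a₂, a₃, a₄, ← c₁]
  have assemble : ∀ {x y P Q R U V V' W X C D A B : KQT}, x * y = 1 → C * A = D * B →
      ∀ z w : KQT, z * (w * P) * (C / Q) * R * (U / V) * (x * (W / V')) * (y * X) * A =
        z * w * P * (D / Q) * R * (W * U / (V' * V)) * X * B := by
    intro x y P Q R U V V' W X C D A B hxy hCA z w
    calc _ = z * w * P * (C * A) / Q * R * (W * U / (V' * V)) * X * (x * y) := by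
          rw [mul_div_mul_comm]; ring
      _ = _ := by rw [hxy, hCA]; ring
  exact assemble c₂ c₃ _ _
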